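/- arXiv:1909.11354 — 3 statements merged into one kernel-verified Lean document; each statement's English description precedes it below -/
import Mathlib

section
/- Let D̃ denote the group, under composition, of all C^∞ maps f : ℝ → ℝ with f'(x) > 0 for all x and f(x + 2π) = f(x) + 2π for all x. For f̃₁, f̃₂ ∈ D̃ and any k₁, k₂ ∈ ℤ, writing t_k(x) = x + 2πk, one has ∫₀^{2π} [(f̃₁∘t_{k₁})(x) + (f̃₂∘t_{k₂})(x) − ((f̃₁∘t_{k₁})∘(f̃₂∘t_{k₂}))(x)] dx = ∫₀^{2π} [f̃₁(x) + f̃₂(x) − (f̃₁∘f̃₂)(x)] dx. Consequently, for α ∈ ℝ the value χ^α(f₁,f₂) := (α/2)·∫₀^{2π}(f̃₁(x) + f̃₂(x) − f̃₁(f̃₂(x)))dx − π²α depends only on the classes f₁, f₂ of f̃₁, f̃₂ modulo the central subgroup of translations {t_k : k ∈ ℤ}. -/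
open Real

theorem map_add_two_pi_mul_int {f : ℝ → ℝ} (hf : ∀ x, f (x + 2 * π) = f x + 2 * π)
    (k : ℤ) (x : ℝ) : f (x + 2 * π * k) = f x + 2 * π * k := by
  induction k using Int.induction_on generalizing x with
  | zero => simp
  | succ n ih =>
    have h := hf (x + 2 * π * (n : ℤ))
    rw [ih] at h
    convert h using 1
    · congr 1; push_cast; ring
    · push_cast; ring
  | pred n ih =>
    have h := hf (x + 2 * π * ((-(n : ℤ) - 1 : ℤ) : ℝ))
    rw [show x + 2 * π * ((-(n : ℤ) - 1 : ℤ) : ℝ) + 2 * π = x + 2 * π * ((-(n : ℤ) : ℤ) : ℝ) by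
      push_cast; ring, ih] at h
    push_cast at h ⊢
    linarith

/-- For `f̃₁, f̃₂` in the universal cover `D̃` of `Diff⁺(S¹)` and any
`k₁, k₂ : ℤ`, with `t_k x = x + 2πk`, the integral
`∫₀^{2π} (f̃₁∘t_{k₁} + f̃₂∘t_{k₂} - (f̃₁∘t_{k₁})∘(f̃₂∘t_{k₂}))` equals
`∫₀^{2π} (f̃₁ + f̃₂ - f̃₁∘f̃₂)`; consequently the Euler cocycle value
`χ^α (f₁,f₂) = (α/2) ∫₀^{2π} (f̃₁ + f̃₂ - f̃₁∘f̃₂) - π²α` depends only on the classes of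
`f̃₁, f̃₂` modulo the central subgroup of translations `{t_k}`. -/
theorem euler_cocycle_integral_independent_of_lift (α : ℝ) (f₁ f₂ : ℝ → ℝ)
    (hf₁ : ContDiff ℝ (⊤ : ℕ∞) f₁) (hf₁' : ∀ x, 0 < deriv f₁ x)
    (hper₁ : ∀ x, f₁ (x + 2 * π) = f₁ x + 2 * π)
    (hf₂ : ContDiff ℝ (⊤ : ℕ∞) f₂) (hf₂' : ∀ x, 0 < deriv f₂ x)
    (hper₂ : ∀ x, f₂ (x + 2 * π) = f₂ x + 2 * π) (k₁ k₂ : ℤ) :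
    (∫ x in (0:ℝ)..(2 * π),
        (f₁ (x + 2 * π * k₁) + f₂ (x + 2 * π * k₂) - f₁ (f₂ (x + 2 * π * k₂) + 2 * π * k₁)))
      = (∫ x in (0:ℝ)..(2 * π), (f₁ x + f₂ x - f₁ (f₂ x))) ∧
    (α / 2 * (∫ x in (0:ℝ)..(2 * π),
        (f₁ (x + 2 * π * k₁) + f₂ (x + 2 * π * k₂) - f₁ (f₂ (x + 2 * π * k₂) + 2 * π * k₁)))
        - π ^ 2 * α
      = α / 2 * (∫ x in (0:ℝ)..(2 * π), (f₁ x + f₂ x - f₁ (f₂ x))) - π ^ 2 * α) := by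
  have integrand_eq (x : ℝ) :
      f₁ (x + 2 * π * k₁) + f₂ (x + 2 * π * k₂) - f₁ (f₂ (x + 2 * π * k₂) + 2 * π * k₁)
        = f₁ x + f₂ x - f₁ (f₂ x) := by
    simp only [map_add_two_pi_mul_int hper₁, map_add_two_pi_mul_int hper₂]
    ring
  simp only [integrand_eq, and_self]
end

section
/- Let D̃ denote the group, under composition, of all C^∞ maps f : ℝ → ℝ with f'(x) > 0 for all x and f(x + 2π) = f(x) + 2π for all x. Fix α ∈ ℝ and define χ^α(f₁,f₂) = (α/2)·∫₀^{2π}(f₁(x) + f₂(x) − f₁(f₂(x)))dx − π²α. Then χ^α satisfies the group 2-cocycle identity: for all f₁, f₂, f₃ ∈ D̃, χ^α(f₁,f₂) + χ^α(f₁∘f₂, f₃) = χ^α(f₁, f₂∘f₃) + χ^α(f₂,f₃). -/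
open Real

/-- Membership in the universal cover `D̃` of `Diff⁺(S¹)`: a `C^∞` map `ℝ → ℝ` with
everywhere positive derivative satisfying `f (x + 2π) = f x + 2π`. -/
def IsDt (f : ℝ → ℝ) : Prop :=
  ContDiff ℝ (⊤ : ℕ∞) f ∧ (∀ x, 0 < deriv f x) ∧ ∀ x, f (x + 2 * π) = f x + 2 * π

/-- The Euler cocycle `χ^α` of the generalized Virasoro construction. -/
noncomputable def chiA (α : ℝ) (f₁ f₂ : ℝ → ℝ) : ℝ :=
  α / 2 * (∫ x in (0:ℝ)..(2 * π), (f₁ x + f₂ x - f₁ (f₂ x))) - π ^ 2 * α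

/-- The Euler cocycle
`χ^α (f₁, f₂) = (α/2) ∫₀^{2π} (f₁ + f₂ - f₁∘f₂) - π²α` satisfies the group 2-cocycle
identity `χ^α(f₁,f₂) + χ^α(f₁∘f₂, f₃) = χ^α(f₁, f₂∘f₃) + χ^α(f₂,f₃)` on `D̃`. -/
theorem chiA_two_cocycle (α : ℝ) (f₁ f₂ f₃ : ℝ → ℝ)
    (h₁ : IsDt f₁) (h₂ : IsDt f₂) (h₃ : IsDt f₃) :
    chiA α f₁ f₂ + chiA α (f₁ ∘ f₂) f₃ = chiA α f₁ (f₂ ∘ f₃) + chiA α f₂ f₃ := by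
  have c₁ : Continuous f₁ := h₁.1.continuous
  have c₂ : Continuous f₂ := h₂.1.continuous
  have c₃ : Continuous f₃ := h₃.1.continuous
  have key : (∫ x in (0:ℝ)..(2 * π), (f₁ x + f₂ x - f₁ (f₂ x))) +
        (∫ x in (0:ℝ)..(2 * π), (f₁ (f₂ x) + f₃ x - f₁ (f₂ (f₃ x)))) =
      (∫ x in (0:ℝ)..(2 * π), (f₁ x + f₂ (f₃ x) - f₁ (f₂ (f₃ x)))) +
        ∫ x in (0:ℝ)..(2 * π), (f₂ x + f₃ x - f₂ (f₃ x)) := by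
    rw [← intervalIntegral.integral_add, ← intervalIntegral.integral_add]
    · congr 1
      ext x
      ring
    all_goals exact Continuous.intervalIntegrable (by fun_prop) _ _
  simp only [chiA, Function.comp_apply]
  linear_combination α / 2 * key
end

section
/- Let X : ℝ → ℝ be C^∞ and 2π-periodic, and let φ : ℝ × ℝ → ℝ be a C^∞ map satisfying φ(x,0) = x for all x, ∂_t φ(x,t) = X(φ(x,t)) for all (x,t), and ∂_x φ(x,t) > 0 for all (x,t) (so t ↦ φ(·,t) is the one-parameter flow exp(tX)). Then the geodesic equation of the right-invariant L²-metric on Diff(S¹), namely 2·∂_x∂_t φ(x,t)·∂_t φ(x,t) + ∂_t∂_t φ(x,t)·∂_x φ(x,t) = 0 for all (x,t), holds if and only if X is a constant function. (In particular, exp(tX) is a geodesic precisely for X = const; these are nontrivial geodesics when the constant is nonzero.) -/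
open Real

/-- The partial derivative in the first (space) variable. -/
noncomputable def pdx (f : ℝ → ℝ → ℝ) : ℝ → ℝ → ℝ :=
  fun x t => deriv (fun y => f y t) x

/-- The partial derivative in the second (time) variable. -/
noncomputable def pdt (f : ℝ → ℝ → ℝ) : ℝ → ℝ → ℝ :=
  fun x t => deriv (fun s => f x s) t

/-- Let `X : ℝ → ℝ` be `C^∞` and `2π`-periodic and let
`φ : ℝ × ℝ → ℝ` be a `C^∞` map with `φ (x,0) = x`, `∂_t φ (x,t) = X (φ (x,t))` and
`∂_x φ (x,t) > 0` (so `t ↦ φ(·,t)` is the flow `exp (tX)`). Then the geodesic equation of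
the right-invariant `L²` metric on `Diff(S¹)`,
`2 ∂_x∂_t φ · ∂_t φ + ∂_t∂_t φ · ∂_x φ = 0`, holds at every point iff `X` is constant. -/
theorem exp_flow_geodesic_iff_constant (X : ℝ → ℝ)
    (hX : ContDiff ℝ (⊤ : ℕ∞) X) (hXper : ∀ x, X (x + 2 * π) = X x)
    (φ : ℝ → ℝ → ℝ) (hφ : ContDiff ℝ (⊤ : ℕ∞) (fun p : ℝ × ℝ => φ p.1 p.2))
    (h0 : ∀ x, φ x 0 = x)
    (hflow : ∀ x t, pdt φ x t = X (φ x t))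
    (hx : ∀ x t, 0 < pdx φ x t) :
    (∀ x t, 2 * pdx (pdt φ) x t * pdt φ x t + pdt (pdt φ) x t * pdx φ x t = 0)
      ↔ ∃ c : ℝ, X = fun _ => c := by
  constructor
  · intro h
    have hXd : Differentiable ℝ X := hX.differentiable (by simp)
    have hmul : ∀ x, X x * deriv X x = 0 := by
      intro x
      have hpt : pdt φ x 0 = X x := by rw [hflow, h0]
      have hpx : pdx φ x 0 = 1 := by simp [pdx, h0]
      have hpxt : pdx (pdt φ) x 0 = deriv X x := by simp [pdx, hflow, h0]
      have hφd : DifferentiableAt ℝ (fun s => φ x s) 0 :=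
        ((hφ.differentiable (by simp)).comp
          ((differentiable_const x).prodMk differentiable_id)) 0
      have hφt : HasDerivAt (fun s => φ x s) (X x) 0 := hpt ▸ hφd.hasDerivAt
      have hptt : pdt (pdt φ) x 0 = deriv X x * X x := by
        have hX0 : HasDerivAt X (deriv X x) (φ x 0) := by
          rw [h0]
          exact (hXd x).hasDerivAt
        have hcomp : HasDerivAt (fun s => X (φ x s)) (deriv X x * X x) 0 := hX0.comp 0 hφt
        simp only [pdt] at hflow ⊢
        simpa only [hflow] using hcomp.deriv
      have hgeo := h x 0
      rw [hpt, hpx, hpxt, hptt] at hgeo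
      linarith
    have hsq : ∀ x y, X x ^ 2 = X y ^ 2 := by
      refine is_const_of_deriv_eq_zero (hXd.pow 2) fun x => ?_
      rw [((hXd x).hasDerivAt.fun_pow 2).deriv]
      linear_combination 2 * hmul x
    refine ⟨X 0, funext fun x => ?_⟩
    by_cases hzero : X 0 = 0
    · have hx0 := hsq x 0
      simpa [hzero] using hx0
    · refine is_const_of_deriv_eq_zero hXd (fun y => ?_) x 0
      refine (mul_eq_zero.mp (hmul y)).resolve_left fun hy => hzero ?_
      have hy0 := hsq 0 y
      simpa [hy] using hy0
  · rintro ⟨c, rfl⟩ x t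
    have hpt : pdt φ = fun _ _ => c := by
      funext y s
      exact hflow y s
    rw [hpt]
    simp [pdx, pdt]
end
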